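/- arXiv:2006.09934 — 5 statements merged into one kernel-verified Lean document; each statement's English description precedes it below -/
import Mathlib

section
/- Let d ≥ 1, s > 0, and let f be a proper log-concave function on ℝ^d with B^{d+1} ⊆ lift_s(f). Assume there exist k ≥ 1, contact points ū_1, …, ū_k ∈ ∂B^{d+1} ∩ ∂lift_s(f) and positive reals c_1, …, c_k such that Σ_{i=1}^k c_i ū_i ⊗ ū_i = S̄ and Σ_{i=1}^k c_i u_i = 0, where S̄ = diag(1, …, 1, s) is the (d+1)×(d+1) diagonal matrix with d entries 1 and last entry s, and u_i is the orthogonal projection of ū_i onto ℝ^d. Then B^{d+1} is the unique ellipsoid of globally maximal s-volume among all d-symmetric ellipsoids contained in lift_s(f): every d-symmetric ellipsoid Ē ⊆ lift_s(f) with Ē ≠ B^{d+1} satisfies μ_s(Ē) < μ_s(B^{d+1}) = κ_s. -/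
open MeasureTheory
open scoped BigOperators RealInnerProductSpace

noncomputable section

/-- `ℝ^d` with the Euclidean structure. -/
abbrev Ed (d : ℕ) := EuclideanSpace ℝ (Fin d)

/-- `f : ℝ^d → [0,∞)` is log-concave, i.e. `f = e^{-ψ}` for some convex
`ψ : ℝ^d → ℝ ∪ {∞}`; equivalently, `f ≥ 0` and
`f(tx+(1-t)y) ≥ f(x)^t f(y)^{1-t}`. -/
def IsLogConcave {d : ℕ} (f : Ed d → ℝ) : Prop :=
  (∀ x, 0 ≤ f x) ∧
    ∀ x y : Ed d, ∀ t : ℝ, 0 ≤ t → t ≤ 1 →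
      f x ^ t * f y ^ (1 - t) ≤ f (t • x + (1 - t) • y)

/-- A proper log-concave function: log-concave, upper semicontinuous,
with positive finite integral. -/
def ProperLogConcave {d : ℕ} (f : Ed d → ℝ) : Prop :=
  IsLogConcave f ∧ UpperSemicontinuous f ∧
    0 < ∫⁻ x, ENNReal.ofReal (f x) ∧ (∫⁻ x, ENNReal.ofReal (f x)) < ⊤

/-- The `s`-lifting of `f`, a subset of `ℝ^d × ℝ = ℝ^{d+1}`. -/
def sLift {d : ℕ} (s : ℝ) (f : Ed d → ℝ) : Set (Ed d × ℝ) :=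
  {p | |p.2| ≤ f p.1 ^ (1 / s)}

/-- The `d`-symmetric ellipsoid `(A⊕α)B^{d+1} + a` in `ℝ^{d+1} = ℝ^d × ℝ`. -/
def ellE {d : ℕ} (A : Matrix (Fin d) (Fin d) ℝ) (α : ℝ) (a : Ed d) : Set (Ed d × ℝ) :=
  {p | ∃ y : Ed d, ∃ t : ℝ, ‖y‖ ^ 2 + t ^ 2 ≤ 1 ∧
        p.1 = Matrix.toEuclideanLin A y + a ∧ p.2 = α * t}

/-- The closed Euclidean unit ball `B^{d+1}` of `ℝ^{d+1} = ℝ^d × ℝ`. -/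
def unitBallE (d : ℕ) : Set (Ed d × ℝ) := {p | ‖p.1‖ ^ 2 + p.2 ^ 2 ≤ 1}

/-- `κ_s = ∫_{B^d} (1-|x|²)^{s/2} dx`. -/
def kappa (d : ℕ) (s : ℝ) : ℝ :=
  ∫ x in Metric.closedBall (0 : Ed d) 1, (1 - ‖x‖ ^ 2) ^ (s / 2)

/-- The `s`-volume of the ellipsoid represented by `(A⊕α, a)`:
`μ_s = κ_s α^s det A`. -/
def svol {d : ℕ} (s : ℝ) (A : Matrix (Fin d) (Fin d) ℝ) (α : ℝ) : ℝ :=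
  kappa d s * α ^ s * A.det

/-- `(A, α, a)` represents the John `s`-ellipsoid of `f`: it is a d-symmetric
ellipsoid contained in the `s`-lifting of `f` of maximal `s`-volume. -/
def IsJohn {d : ℕ} (s : ℝ) (f : Ed d → ℝ)
    (A : Matrix (Fin d) (Fin d) ℝ) (α : ℝ) (a : Ed d) : Prop :=
  A.PosDef ∧ 0 < α ∧ ellE A α a ⊆ sLift s f ∧
    ∀ (A' : Matrix (Fin d) (Fin d) ℝ) (α' : ℝ) (a' : Ed d),
      A'.PosDef → 0 < α' → ellE A' α' a' ⊆ sLift s f → svol s A' α' ≤ svol s A α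

/-- The height function of the ellipsoid represented by `(A⊕α, a)`. -/
def heightFn {d : ℕ} (A : Matrix (Fin d) (Fin d) ℝ) (α : ℝ) (a : Ed d) (x : Ed d) : ℝ :=
  if ‖Matrix.toEuclideanLin A⁻¹ (x - a)‖ ≤ 1 then
    α * Real.sqrt (1 - ‖Matrix.toEuclideanLin A⁻¹ (x - a)‖ ^ 2)
  else 0

/-- A point of `ℝ^d × ℝ` as a vector in `ℝ^{d+1}`. -/
def augVec {d : ℕ} (p : Ed d × ℝ) : Fin (d + 1) → ℝ :=
  Fin.snoc (fun i => p.1 i) p.2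

/-- The block-diagonal matrix `A ⊕ α`. -/
def matAug {d : ℕ} (A : Matrix (Fin d) (Fin d) ℝ) (α : ℝ) :
    Matrix (Fin (d + 1)) (Fin (d + 1)) ℝ :=
  Matrix.of fun i j =>
    Fin.lastCases (Fin.lastCases α (fun _ => 0) j)
      (fun i' => Fin.lastCases 0 (fun j' => A i' j') j) i

/-- The Frobenius norm of a real matrix. -/
def frobNorm {n : ℕ} (M : Matrix (Fin n) (Fin n) ℝ) : ℝ :=
  Real.sqrt (∑ i, ∑ j, M i j ^ 2)

/-- Asplund sum (sup-convolution) of two functions. -/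
def asplund {d : ℕ} (f g : Ed d → ℝ) : Ed d → ℝ :=
  fun x => ⨆ y : Ed d, f y * g (x - y)

/-- Epi-product `(λ ∗ f)(x) = f(x/λ)^λ`. -/
def epiProd {d : ℕ} (l : ℝ) (f : Ed d → ℝ) : Ed d → ℝ :=
  fun x => f (l⁻¹ • x) ^ l

/-- The flat ellipsoid function `α · χ_{A B^d + a}`. -/
def flatFn {d : ℕ} (A : Matrix (Fin d) (Fin d) ℝ) (α : ℝ) (a : Ed d) (x : Ed d) : ℝ :=
  if ‖Matrix.toEuclideanLin A⁻¹ (x - a)‖ ≤ 1 then α else 0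

/-- The Gaussian density `G[(A⊕α, a)](x) = α e^{−|A^{-1}(x−a)|²}`. -/
def gaussFn {d : ℕ} (A : Matrix (Fin d) (Fin d) ℝ) (α : ℝ) (a : Ed d) (x : Ed d) : ℝ :=
  α * Real.exp (-‖Matrix.toEuclideanLin A⁻¹ (x - a)‖ ^ 2)

/-- Operator (`ℓ₂ → ℓ₂`) norm of a matrix. -/
def opNorm {d : ℕ} (M : Matrix (Fin d) (Fin d) ℝ) : ℝ :=
  ‖Matrix.toEuclideanCLM (𝕜 := ℝ) M‖

lemma sqrt_one_sub_sq_le_height {d : ℕ} {s : ℝ} {f : Ed d → ℝ} (hf : ∀ x, 0 ≤ f x)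
    (hB : unitBallE d ⊆ sLift s f) (y : Ed d) :
    √(1 - ‖y‖ ^ 2) ≤ f y ^ (1 / s) := by
  rcases le_total (1 - ‖y‖ ^ 2) 0 with h | h
  · rw [Real.sqrt_eq_zero_of_nonpos h]
    exact Real.rpow_nonneg (hf y) _
  · have hy : (y, √(1 - ‖y‖ ^ 2)) ∈ sLift s f := by
      apply hB
      simp [unitBallE, Real.sq_sqrt h]
    exact (le_abs_self _).trans hy

lemma height_interpolation {d : ℕ} {s : ℝ} {f : Ed d → ℝ} (hf : IsLogConcave f) (hs : 0 < s)
    (x y : Ed d) {t : ℝ} (h0 : 0 ≤ t) (h1 : t ≤ 1) :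
    (f x ^ (1 / s)) ^ t * (f y ^ (1 / s)) ^ (1 - t) ≤ f (t • x + (1 - t) • y) ^ (1 / s) := by
  have h := Real.rpow_le_rpow (mul_nonneg (Real.rpow_nonneg (hf.1 x) t)
    (Real.rpow_nonneg (hf.1 y) (1 - t))) (hf.2 x y t h0 h1) (by positivity : 0 ≤ 1 / s)
  rw [Real.mul_rpow (Real.rpow_nonneg (hf.1 x) t) (Real.rpow_nonneg (hf.1 y) _)] at h
  rwa [← Real.rpow_mul (hf.1 x), mul_comm _ t, Real.rpow_mul (hf.1 x),
    ← Real.rpow_mul (hf.1 y), mul_comm _ (1 - t), Real.rpow_mul (hf.1 y)]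

/-- Interpolating between a point of the lifting and the unit ball bounds the height at any
point that is not interior to the lifting. -/
lemma interpolated_height_le {d : ℕ} {s : ℝ} {f : Ed d → ℝ} (hf : IsLogConcave f) (hs : 0 < s)
    (hB : unitBallE d ⊆ sLift s f) {p : Ed d × ℝ} (hp : p ∉ interior (sLift s f))
    {x : Ed d} {m : ℝ} (hm : 0 ≤ m) (hx : m ≤ f x ^ (1 / s)) {t : ℝ} (h0 : 0 ≤ t) (h1 : t < 1) :
    m ^ t * √(1 - ‖(1 - t)⁻¹ • (p.1 - t • x)‖ ^ 2) ^ (1 - t) ≤ |p.2| := by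
  by_contra! h
  refine hp (mem_interior.2 ⟨{q : Ed d × ℝ |
    |q.2| < m ^ t * √(1 - ‖(1 - t)⁻¹ • (q.1 - t • x)‖ ^ 2) ^ (1 - t)}, ?_, ?_, h⟩)
  · intro q hq
    set y := (1 - t)⁻¹ • (q.1 - t • x) with hy
    have hq1 : t • x + (1 - t) • y = q.1 := by
      rw [hy, smul_inv_smul₀ (by linarith)]
      abel
    have hint := height_interpolation hf hs x y h0 h1.le
    rw [hq1] at hint
    refine le_trans (le_of_lt hq) (le_trans ?_ hint)
    gcongr
    · exact Real.rpow_nonneg (Real.rpow_nonneg (hf.1 x) _) _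
    · exact sqrt_one_sub_sq_le_height hf.1 hB y
  · apply isOpen_lt (by fun_prop)
    apply Continuous.mul continuous_const
    exact Continuous.rpow_const (by fun_prop) (fun q => Or.inr (by linarith))

lemma one_sub_sq_norm_interpolant {d : ℕ} (u x : Ed d) (τ : ℝ) (hu : ‖u‖ ^ 2 + τ ^ 2 = 1)
    {t : ℝ} (h1 : t < 1) :
    1 - ‖(1 - t)⁻¹ • (u - t • x)‖ ^ 2 =
      (τ ^ 2 - 2 * t * (1 - ⟪u, x⟫) + t ^ 2 * (1 - ‖x‖ ^ 2)) / (1 - t) ^ 2 := by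
  have h : 1 - t ≠ 0 := by linarith
  rw [norm_smul, mul_pow, norm_sub_sq_real, inner_smul_right, norm_smul, norm_inv, mul_pow,
    inv_pow, Real.norm_eq_abs, Real.norm_eq_abs, sq_abs, sq_abs]
  field_simp
  linear_combination -hu

lemma deriv_nonpos_of_forall_le {F : ℝ → ℝ} {D : ℝ} (hF : HasDerivAt F D 0)
    (h : ∀ᶠ t in nhdsWithin 0 (Set.Ioi 0), F t ≤ F 0) : D ≤ 0 := by
  have hs := (hasDerivAt_iff_tendsto_slope.1 hF).mono_left
    (nhdsWithin_mono 0 (s := Set.Ioi 0) (fun t ht => ne_of_gt ht))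
  refine le_of_tendsto hs ?_
  filter_upwards [h, self_mem_nhdsWithin] with t ht h0
  rw [slope_def_field]
  exact div_nonpos_of_nonpos_of_nonneg (by linarith) (by simpa using (le_of_lt h0))

/-- At an equatorial contact point the support of `f` lies in the tangent half-space. -/
lemma inner_le_one_of_equatorial_contact {d : ℕ} {s : ℝ} {f : Ed d → ℝ} (hf : IsLogConcave f)
    (hs : 0 < s) (hB : unitBallE d ⊆ sLift s f) {u : Ed d} (hu : ‖u‖ ^ 2 = 1)
    (hp : (u, (0 : ℝ)) ∉ interior (sLift s f)) {x : Ed d} {m : ℝ} (hm : 0 < m)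
    (hx : m ≤ f x ^ (1 / s)) : ⟪u, x⟫ ≤ 1 := by
  have key : ∀ᶠ t in nhdsWithin (0 : ℝ) (Set.Ioi 0),
      t * (1 - ‖x‖ ^ 2) - 2 * (1 - ⟪u, x⟫) ≤ 0 := by
    filter_upwards [Ioo_mem_nhdsGT (zero_lt_one' ℝ)] with t ⟨h0, h1⟩
    have h := interpolated_height_le hf hs hB hp hm.le hx h0.le h1
    simp only [abs_zero] at h
    rw [one_sub_sq_norm_interpolant u x 0 (by simpa using hu) h1] at h
    by_contra! hpos
    refine absurd h (not_le.2 ?_)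
    have h2 : 0 < 1 - t := by linarith
    have : 0 < (0 : ℝ) ^ 2 - 2 * t * (1 - ⟪u, x⟫) + t ^ 2 * (1 - ‖x‖ ^ 2) := by
      nlinarith [mul_pos h0 hpos]
    positivity
  have hlim : Filter.Tendsto (fun t : ℝ => t * (1 - ‖x‖ ^ 2) - 2 * (1 - ⟪u, x⟫))
      (nhdsWithin 0 (Set.Ioi 0)) (nhds (0 * (1 - ‖x‖ ^ 2) - 2 * (1 - ⟪u, x⟫))) :=
    Filter.Tendsto.mono_left (Continuous.tendsto (by fun_prop) 0) nhdsWithin_le_nhds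
  linarith [le_of_tendsto hlim key]

/-- At a contact point off the equator, `f ^ (1 / s)` lies below the log-linear tangent
function of the hemisphere. -/
lemma log_height_le_of_contact {d : ℕ} {s : ℝ} {f : Ed d → ℝ} (hf : IsLogConcave f)
    (hs : 0 < s) (hB : unitBallE d ⊆ sLift s f) {u : Ed d} {τ : ℝ} (hτ : τ ≠ 0)
    (hu : ‖u‖ ^ 2 + τ ^ 2 = 1) (hp : (u, τ) ∉ interior (sLift s f)) {x : Ed d} {m : ℝ}
    (hm : 0 < m) (hx : m ≤ f x ^ (1 / s)) :
    τ ^ 2 * (Real.log m - Real.log τ) + ⟪u, x⟫ ≤ ‖u‖ ^ 2 := by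
  set N : ℝ → ℝ := fun t => τ ^ 2 - 2 * t * (1 - ⟪u, x⟫) + t ^ 2 * (1 - ‖x‖ ^ 2) with hN
  have hτ2 : 0 < τ ^ 2 := by positivity
  have hN0 : N 0 = τ ^ 2 := by simp [hN]
  have hNd : HasDerivAt N (-(2 * (1 - ⟪u, x⟫))) 0 := by
    have h1 := (((hasDerivAt_id (0 : ℝ)).const_mul 2).mul_const (1 - ⟪u, x⟫)).const_sub (τ ^ 2)
    have h2 := ((hasDerivAt_id (0 : ℝ)).pow 2).mul_const (1 - ‖x‖ ^ 2)
    refine (h1.add h2).congr_deriv ?_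
    simp
  have hlogN := hNd.log (by rw [hN0]; exact hτ2.ne')
  have hlog1 := ((hasDerivAt_id (0 : ℝ)).const_sub 1).log (by simp)
  have hF := ((hasDerivAt_id (0 : ℝ)).mul_const (Real.log m)).add
    (((hasDerivAt_id (0 : ℝ)).const_sub 1).mul
      ((hlogN.const_mul (1 / 2)).sub hlog1))
  have hlogτ : Real.log (τ ^ 2) = 2 * Real.log τ := by
    rw [Real.log_pow]; norm_num
  have hD := deriv_nonpos_of_forall_le hF (by
    have hpos : ∀ᶠ t in nhdsWithin (0 : ℝ) (Set.Ioi 0), 0 < N t :=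
      (hNd.continuousAt.eventually (lt_mem_nhds (by rw [hN0]; exact hτ2))).filter_mono
        nhdsWithin_le_nhds
    filter_upwards [Ioo_mem_nhdsGT (zero_lt_one' ℝ), hpos] with t ⟨h0, h1⟩ hNt
    have h := interpolated_height_le hf hs hB hp hm.le hx h0.le h1
    rw [one_sub_sq_norm_interpolant u x τ hu h1] at h
    change m ^ t * √(N t / (1 - t) ^ 2) ^ (1 - t) ≤ |τ| at h
    have h2 : 0 < 1 - t := by linarith
    have hl := Real.log_le_log (by positivity) h
    rw [Real.log_mul (by positivity) (by positivity), Real.log_rpow hm,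
      Real.log_rpow (by positivity), Real.log_sqrt (by positivity),
      Real.log_div hNt.ne' (by positivity), Real.log_pow, Real.log_abs] at hl
    simp only [Pi.add_apply, Pi.mul_apply, Pi.sub_apply, id, hN0, hlogτ]
    push_cast at hl
    norm_num
    linarith)
  simp only [id, hN0, hlogτ, Pi.sub_apply] at hD
  norm_num at hD
  have hD' : Real.log m - Real.log τ + 1 - (1 - ⟪u, x⟫) / τ ^ 2 ≤ 0 := by
    refine le_of_eq_of_le ?_ hD
    field_simp
    ring
  have := mul_le_mul_of_nonneg_left hD' hτ2.le
  rw [mul_zero] at this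
  have e : τ ^ 2 * (Real.log m - Real.log τ + 1 - (1 - ⟪u, x⟫) / τ ^ 2) =
      τ ^ 2 * (Real.log m - Real.log τ) + τ ^ 2 - (1 - ⟪u, x⟫) := by
    field_simp
  linarith

lemma contact_inequality {d : ℕ} {s : ℝ} {f : Ed d → ℝ} (hf : IsLogConcave f)
    (hs : 0 < s) (hB : unitBallE d ⊆ sLift s f) {p : Ed d × ℝ}
    (hu : ‖p.1‖ ^ 2 + p.2 ^ 2 = 1) (hp : p ∉ interior (sLift s f))
    {A : Matrix (Fin d) (Fin d) ℝ} {α : ℝ} {a : Ed d} (hα : 0 < α)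
    (hE : ellE A α a ⊆ sLift s f) :
    p.2 ^ 2 * Real.log α + ⟪p.1, Matrix.toEuclideanLin A p.1⟫ + ⟪p.1, a⟫ ≤ ‖p.1‖ ^ 2 := by
  obtain ⟨u, τ⟩ := p
  simp only at hu ⊢
  have hmem : ∀ (y : Ed d) (t : ℝ), ‖y‖ ^ 2 + t ^ 2 ≤ 1 →
      α * |t| ≤ f (Matrix.toEuclideanLin A y + a) ^ (1 / s) := by
    intro y t h
    have : (Matrix.toEuclideanLin A y + a, α * t) ∈ sLift s f := hE ⟨y, t, h, rfl, rfl⟩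
    simpa [sLift, abs_mul, abs_of_pos hα] using this
  by_cases hτ : τ = 0
  · subst hτ
    have hu1 : ‖u‖ ^ 2 = 1 := by simpa using hu
    have key : ∀ᶠ r in nhdsWithin (1 : ℝ) (Set.Iio 1),
        r * ⟪u, Matrix.toEuclideanLin A u⟫ + ⟪u, a⟫ ≤ 1 := by
      filter_upwards [Ioo_mem_nhdsLT (zero_lt_one' ℝ)] with r ⟨h0, h1⟩
      have hr : 0 < 1 - r ^ 2 := by nlinarith
      have h := hmem (r • u) (√(1 - r ^ 2)) (by
        rw [norm_smul, mul_pow, hu1, Real.sq_sqrt hr.le, Real.norm_eq_abs, sq_abs]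
        linarith)
      have := inner_le_one_of_equatorial_contact hf hs hB hu1 hp (by positivity) h
      simpa [inner_add_right, inner_smul_right] using this
    have hlim : Filter.Tendsto (fun r : ℝ => r * ⟪u, Matrix.toEuclideanLin A u⟫ + ⟪u, a⟫)
        (nhdsWithin 1 (Set.Iio 1)) (nhds (1 * ⟪u, Matrix.toEuclideanLin A u⟫ + ⟪u, a⟫)) :=
      Filter.Tendsto.mono_left (Continuous.tendsto (by fun_prop) 1) nhdsWithin_le_nhds
    have := le_of_tendsto hlim key
    rw [hu1]
    linarith
  · have hτ' : 0 < |τ| := abs_pos.2 hτ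
    have h := log_height_le_of_contact hf hs hB hτ hu hp (by positivity) (hmem u τ hu.le)
    rw [Real.log_mul hα.ne' hτ'.ne', Real.log_abs, inner_add_right] at h
    linarith

lemma Matrix.PosDef.log_det_lt_trace_sub {d : ℕ} {A : Matrix (Fin d) (Fin d) ℝ}
    (hA : A.PosDef) (h1 : A ≠ 1) : Real.log A.det < A.trace - d := by
  have hex : ∃ i, hA.1.eigenvalues i ≠ 1 := by
    by_contra! h
    apply h1
    rw [hA.1.spectral_theorem, show (RCLike.ofReal ∘ hA.1.eigenvalues : Fin d → ℝ) = 1 by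
      ext i; simp [h i], show Matrix.diagonal (1 : Fin d → ℝ) = 1 from Matrix.diagonal_one,
      map_one]
  obtain ⟨i, hi⟩ := hex
  have h := Finset.sum_lt_sum (fun i (_ : i ∈ Finset.univ) =>
    Real.log_le_sub_one_of_pos (hA.eigenvalues_pos i))
    ⟨i, Finset.mem_univ i, Real.log_lt_sub_one_of_pos (hA.eigenvalues_pos i) hi⟩
  rw [hA.1.det_eq_prod_eigenvalues, hA.1.trace_eq_sum_eigenvalues]
  simp only [RCLike.ofReal_real_eq_id, id]
  rw [Real.log_prod (fun i _ => (hA.eigenvalues_pos i).ne')]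
  simpa using h

lemma kappa_pos (d : ℕ) {s : ℝ} (hs : 0 < s) : 0 < kappa d s := by
  have hcont : Continuous fun x : Ed d => (1 - ‖x‖ ^ 2) ^ (s / 2) :=
    Continuous.rpow_const (by fun_prop) (fun _ => Or.inr (by positivity))
  have hnn : ∀ x ∈ Metric.closedBall (0 : Ed d) 1, 0 ≤ 1 - ‖x‖ ^ 2 := by
    intro x hx
    rw [mem_closedBall_zero_iff] at hx
    nlinarith [norm_nonneg x]
  rw [kappa, setIntegral_pos_iff_support_of_nonneg_ae]
  · refine lt_of_lt_of_le (Metric.measure_ball_pos volume (0 : Ed d) one_pos)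
      (measure_mono fun x hx => ⟨?_, Metric.ball_subset_closedBall hx⟩)
    rw [mem_ball_zero_iff] at hx
    have : 0 < 1 - ‖x‖ ^ 2 := by nlinarith [norm_nonneg x]
    exact (Real.rpow_pos_of_pos this _).ne'
  · filter_upwards [ae_restrict_mem measurableSet_closedBall] with x hx
    exact Real.rpow_nonneg (hnn x hx) _
  · exact hcont.continuousOn.integrableOn_compact (isCompact_closedBall 0 1)

section Decomposition

variable {d k : ℕ} {s : ℝ} {u : Fin k → Ed d × ℝ} {c : Fin k → ℝ}

lemma sum_smul_coord_mul
    (hmat : (∑ i, c i • Matrix.vecMulVec (augVec (u i)) (augVec (u i))) =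
      Matrix.diagonal (Fin.snoc (fun _ : Fin d => (1 : ℝ)) s)) (p q : Fin d) :
    ∑ i, c i * ((u i).1 p * (u i).1 q) = (1 : Matrix (Fin d) (Fin d) ℝ) p q := by
  have h := congrFun (congrFun hmat p.castSucc) q.castSucc
  simpa [Matrix.sum_apply, Matrix.vecMulVec_apply, augVec, Matrix.diagonal_apply,
    Matrix.one_apply] using h

lemma sum_smul_height_sq
    (hmat : (∑ i, c i • Matrix.vecMulVec (augVec (u i)) (augVec (u i))) =
      Matrix.diagonal (Fin.snoc (fun _ : Fin d => (1 : ℝ)) s)) :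
    ∑ i, c i * (u i).2 ^ 2 = s := by
  have h := congrFun (congrFun hmat (Fin.last d)) (Fin.last d)
  simpa [Matrix.sum_apply, Matrix.vecMulVec_apply, augVec, Matrix.diagonal_apply, ← sq] using h

lemma sum_smul_inner_toEuclideanLin
    (hmat : (∑ i, c i • Matrix.vecMulVec (augVec (u i)) (augVec (u i))) =
      Matrix.diagonal (Fin.snoc (fun _ : Fin d => (1 : ℝ)) s)) (A : Matrix (Fin d) (Fin d) ℝ) :
    ∑ i, c i * ⟪(u i).1, Matrix.toEuclideanLin A (u i).1⟫ = A.trace := by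
  have h : ∀ i, c i * ⟪(u i).1, Matrix.toEuclideanLin A (u i).1⟫ =
      ∑ p, ∑ q, A p q * (c i * ((u i).1 p * (u i).1 q)) := by
    intro i
    simp only [PiLp.inner_apply, Matrix.ofLp_toLpLin, Matrix.toLin'_apply, Matrix.mulVec, dotProduct,
      RCLike.inner_apply, conj_trivial, Finset.mul_sum, Finset.sum_mul]
    exact Finset.sum_congr rfl fun p _ => Finset.sum_congr rfl fun q _ => by ring
  simp only [h]
  rw [Finset.sum_comm]
  simp only [Finset.sum_comm (s := (Finset.univ : Finset (Fin k))), ← Finset.mul_sum,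
    sum_smul_coord_mul hmat]
  simp [Matrix.one_apply, Matrix.trace]

lemma sum_smul_inner_sq
    (hmat : (∑ i, c i • Matrix.vecMulVec (augVec (u i)) (augVec (u i))) =
      Matrix.diagonal (Fin.snoc (fun _ : Fin d => (1 : ℝ)) s)) (a : Ed d) :
    ∑ i, c i * ⟪(u i).1, a⟫ ^ 2 = ‖a‖ ^ 2 := by
  have h : ∀ i, c i * ⟪(u i).1, a⟫ ^ 2 =
      c i * ⟪(u i).1, Matrix.toEuclideanLin (Matrix.vecMulVec a a) (u i).1⟫ := by
    intro i
    simp only [PiLp.inner_apply, Matrix.ofLp_toLpLin, Matrix.toLin'_apply, Matrix.mulVec, dotProduct,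
      RCLike.inner_apply, conj_trivial, Matrix.vecMulVec_apply, sq]
    rw [Finset.sum_mul_sum]
    simp only [Finset.sum_mul]
    congr 1
    exact Finset.sum_congr rfl fun p _ => Finset.sum_congr rfl fun q _ => by ring
  simp only [h]
  rw [sum_smul_inner_toEuclideanLin hmat, EuclideanSpace.real_norm_sq_eq]
  simp [Matrix.trace, Matrix.vecMulVec_apply, sq]

end Decomposition

/-- **John's condition, sufficiency** (Theorem 5.1 part (2)). -/
theorem john_condition_global_max (d : ℕ) (hd : 1 ≤ d) (s : ℝ) (hs : 0 < s)
    (f : Ed d → ℝ) (hf : ProperLogConcave f)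
    (hB : unitBallE d ⊆ sLift s f)
    (k : ℕ) (hk : 1 ≤ k) (u : Fin k → Ed d × ℝ) (c : Fin k → ℝ)
    (hu : ∀ i, u i ∈ frontier (unitBallE d) ∩ frontier (sLift s f))
    (hc : ∀ i, 0 < c i)
    (hmat : (∑ i, c i • Matrix.vecMulVec (augVec (u i)) (augVec (u i))) =
      Matrix.diagonal (Fin.snoc (fun _ : Fin d => (1 : ℝ)) s))
    (hcen : (∑ i, c i • (u i).1) = 0) :
    ∀ (A : Matrix (Fin d) (Fin d) ℝ) (α : ℝ) (a : Ed d),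
      A.PosDef → 0 < α → ellE A α a ⊆ sLift s f →
        ¬(A = 1 ∧ α = 1 ∧ a = 0) → svol s A α < kappa d s := by
  intro A α a hA hα hE hne
  have hsphere : ∀ i, ‖(u i).1‖ ^ 2 + (u i).2 ^ 2 = 1 := fun i =>
    frontier_le_subset_eq (f := fun p : Ed d × ℝ => ‖p.1‖ ^ 2 + p.2 ^ 2) (by fun_prop)
      continuous_const (hu i).1
  have hcontact := fun i => contact_inequality hf.1 hs hB (hsphere i) (hu i).2.2 hα hE
  have hcenter : ∑ i, c i * ⟪(u i).1, a⟫ = 0 := by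
    rw [← inner_zero_left (𝕜 := ℝ) a, ← hcen, sum_inner]
    simp [inner_smul_left]
  have hnorm : ∑ i, c i * ‖(u i).1‖ ^ 2 = d := by
    simpa using sum_smul_inner_toEuclideanLin hmat (1 : Matrix (Fin d) (Fin d) ℝ)
  have htrace : s * Real.log α + A.trace ≤ d := by
    have h := Finset.sum_le_sum fun i (_ : i ∈ Finset.univ) =>
      mul_le_mul_of_nonneg_left (hcontact i) (hc i).le
    simp only [mul_add, Finset.sum_add_distrib, ← mul_assoc, ← Finset.sum_mul] at h
    rwa [sum_smul_height_sq hmat, sum_smul_inner_toEuclideanLin hmat, hcenter, hnorm,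
      add_zero] at h
  have hlog : s * Real.log α + Real.log A.det < 0 := by
    by_cases hA1 : A = 1
    · subst hA1
      have hα1 : α ≠ 1 := by
        rintro rfl
        refine hne ⟨rfl, rfl, ?_⟩
        have hle : ∀ i, ⟪(u i).1, a⟫ ≤ 0 := fun i => by
          have := hcontact i
          simp only [Real.log_one, mul_zero, Matrix.toLpLin_one, LinearMap.id_apply,
            real_inner_self_eq_norm_sq] at this
          linarith
        have hzero := (Finset.sum_eq_zero_iff_of_nonpos fun i _ =>
          mul_nonpos_of_nonneg_of_nonpos (hc i).le (hle i)).1 hcenter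
        have hz : ∀ i, ⟪(u i).1, a⟫ = 0 := fun i =>
          (mul_eq_zero.1 (hzero i (Finset.mem_univ i))).resolve_left (hc i).ne'
        have hsq := sum_smul_inner_sq hmat a
        simp only [hz] at hsq
        simpa using hsq.symm
      simp only [Matrix.trace_one, Fintype.card_fin] at htrace
      have hlog0 : Real.log α ≠ 0 := Real.log_ne_zero_of_pos_of_ne_one hα hα1
      simp only [Matrix.det_one, Real.log_one, add_zero]
      exact lt_of_le_of_ne (by linarith) (mul_ne_zero hs.ne' hlog0)
    · linarith [hA.log_det_lt_trace_sub hA1]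
  have hlt : α ^ s * A.det < 1 := by
    have hdet := hA.det_pos
    rw [← Real.log_neg_iff (by positivity), Real.log_mul (by positivity) hdet.ne',
      Real.log_rpow hα]
    exact hlog
  rw [svol, mul_assoc]
  exact mul_lt_of_lt_one_right (kappa_pos d hs) hlt
end
end

section
/- Let ψ_1, ψ_2 : ℝ^d → ℝ ∪ {∞} be convex functions and set f_1 = e^{-ψ_1}, f_2 = e^{-ψ_2}. Assume f_2(x) ≤ f_1(x) for all x ∈ ℝ^d, that f_1(x_0) = f_2(x_0) > 0 at some point x_0 lying in the interior of the effective domain of ψ_2, and that ψ_2 is differentiable at x_0. Then f_1 and f_2 are differentiable at x_0 with ∇f_1(x_0) = ∇f_2(x_0), and f_1(x) ≤ f_2(x_0) · e^{−⟨∇ψ_2(x_0), x − x_0⟩} for all x ∈ ℝ^d. -/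
open MeasureTheory
open scoped BigOperators RealInnerProductSpace

noncomputable section

/-- The supporting hyperplane of `-log g` at `x₀` also supports `-log f` when `g ≤ f` touch at
`x₀` and `f` is log-concave. -/
theorem IsLogConcave.le_mul_exp_of_touching {d : ℕ} {f g : Ed d → ℝ} (hf : IsLogConcave f)
    (hle : ∀ x, g x ≤ f x) {x₀ : Ed d} (heq : f x₀ = g x₀) (hpos : ∀ᶠ y in nhds x₀, 0 < g y)
    {L : Ed d →L[ℝ] ℝ} (hL : HasFDerivAt (fun x => -Real.log (g x)) L x₀) (x : Ed d) :
    f x ≤ g x₀ * Real.exp (-(L (x - x₀))) := by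
  have hg0 : 0 < g x₀ := hpos.self_of_nhds
  rcases (hf.1 x).eq_or_lt with h0 | hfx
  · rw [← h0]; positivity
  set v := x - x₀ with hv
  have hline : HasDerivAt (fun s : ℝ => x₀ - s • v) (-v) 0 := by
    simpa using ((hasDerivAt_id (0 : ℝ)).smul_const v).const_sub x₀
  have hL' : HasFDerivAt (fun x => -Real.log (g x)) L (x₀ - (0 : ℝ) • v) := by simpa using hL
  have hψ := hL'.comp_hasDerivAt (0 : ℝ) hline
  set h : ℝ → ℝ := fun s => s * Real.log (f x) - (1 + s) * Real.log (g x₀)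
    - -Real.log (g (x₀ - s • v)) with hh
  have hder : HasDerivAt h (Real.log (f x) - Real.log (g x₀) - L (-v)) 0 := by
    refine HasDerivAt.sub (HasDerivAt.sub ?_ ?_) hψ
    · simpa using (hasDerivAt_id (0 : ℝ)).mul_const (Real.log (f x))
    · simpa using ((hasDerivAt_id (0 : ℝ)).const_add 1).mul_const (Real.log (g x₀))
  have hh0 : h 0 = 0 := by simp [hh]
  have hev : ∀ᶠ s : ℝ in nhds 0, 0 < g (x₀ - s • v) := by
    have hc : Filter.Tendsto (fun s : ℝ => x₀ - s • v) (nhds 0) (nhds x₀) := by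
      simpa using hline.continuousAt.tendsto
    exact hc.eventually hpos
  have hslope := hder.tendsto_slope.mono_left
    (nhdsWithin_mono (0 : ℝ) fun s (hs : s ∈ Set.Ioi (0 : ℝ)) => ne_of_gt hs)
  have hkey : Real.log (f x) - Real.log (g x₀) - L (-v) ≤ 0 := by
    refine le_of_tendsto hslope ?_
    filter_upwards [self_mem_nhdsWithin, nhdsWithin_le_nhds hev] with s hs hgs
    have hs : 0 < s := hs
    have hfs := hgs.trans_le (hle _)
    rw [slope_def_field, hh0, sub_zero, sub_zero]
    refine div_nonpos_of_nonpos_of_nonneg ?_ hs.le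
    have hlc := hf.2 x (x₀ - s • v) (s / (1 + s)) (by positivity)
      (by rw [div_le_one (by positivity)]; linarith)
    have h1t : 1 - s / (1 + s) = 1 / (1 + s) := by field_simp; ring
    have hpt : (s / (1 + s)) • x + (1 - s / (1 + s)) • (x₀ - s • v) = x₀ := by
      rw [h1t, show x = x₀ + v by simp [hv]]
      have hxv : (s / (1 + s)) • (x₀ + v) + (1 / (1 + s)) • (x₀ - s • v)
          = (s / (1 + s) + 1 / (1 + s)) • x₀ + (s / (1 + s) - 1 / (1 + s) * s) • v := by module
      rw [hxv, show s / (1 + s) + 1 / (1 + s) = 1 by field_simp; ring,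
        show s / (1 + s) - 1 / (1 + s) * s = 0 by ring]
      simp
    rw [hpt, h1t, heq] at hlc
    have hlog := Real.log_le_log (by positivity) hlc
    rw [Real.log_mul (by positivity) (by positivity), Real.log_rpow hfx, Real.log_rpow hfs] at hlog
    have hmono := Real.log_le_log hgs (hle (x₀ - s • v))
    have hmul := mul_le_mul_of_nonneg_left hlog (by positivity : (0 : ℝ) ≤ 1 + s)
    have hexp : (1 + s) * (s / (1 + s) * Real.log (f x)
        + 1 / (1 + s) * Real.log (f (x₀ - s • v)))
        = s * Real.log (f x) + Real.log (f (x₀ - s • v)) := by field_simp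
    simp only [hh]
    linarith
  rw [map_neg] at hkey
  calc f x = Real.exp (Real.log (f x)) := (Real.exp_log hfx).symm
    _ ≤ Real.exp (Real.log (g x₀) + -(L v)) := Real.exp_le_exp.2 (by linarith)
    _ = g x₀ * Real.exp (-(L v)) := by rw [Real.exp_add, Real.exp_log hg0]

/-- A function squeezed between two functions touching at `x₀` with the same derivative there
has that derivative at `x₀`. -/
theorem HasFDerivAt.of_le_of_le {E : Type*} [NormedAddCommGroup E] [NormedSpace ℝ E]
    {f g h : E → ℝ} {f' : E →L[ℝ] ℝ} {x₀ : E} (hg : HasFDerivAt g f' x₀)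
    (hh : HasFDerivAt h f' x₀) (hgf : ∀ x, g x ≤ f x) (hfh : ∀ x, f x ≤ h x)
    (heq : g x₀ = h x₀) : HasFDerivAt f f' x₀ := by
  have hfg : f x₀ = g x₀ := le_antisymm ((hfh x₀).trans heq.ge) (hgf x₀)
  rw [hasFDerivAt_iff_isLittleO] at hg hh ⊢
  refine (Asymptotics.IsBigO.of_bound 1 (Filter.Eventually.of_forall fun x => ?_)).trans_isLittleO
    (hg.norm_left.add hh.norm_left)
  rw [one_mul, Real.norm_of_nonneg (add_nonneg (norm_nonneg _) (norm_nonneg _))]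
  simp only [Real.norm_eq_abs]
  rw [abs_le]
  have h1 := hgf x
  have h2 := hfh x
  constructor
  · linarith [neg_abs_le (g x - g x₀ - f' (x - x₀)), abs_nonneg (h x - h x₀ - f' (x - x₀))]
  · linarith [le_abs_self (h x - h x₀ - f' (x - x₀)), abs_nonneg (g x - g x₀ - f' (x - x₀))]

/-- **Touching condition for log-concave functions** (Lemma 3.1).
Here `ψ_i = -log f_i` (with value `∞` where `f_i = 0`); the effective domain of
`ψ₂` is `{x | 0 < f₂ x}`, and on a neighborhood of `x₀` inside it we have
`ψ₂ = fun x => -Real.log (f₂ x)`. -/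
theorem touching_condition_logconcave (d : ℕ)
    (f₁ f₂ : Ed d → ℝ) (h₁ : IsLogConcave f₁) (h₂ : IsLogConcave f₂)
    (hle : ∀ x, f₂ x ≤ f₁ x) (x₀ : Ed d)
    (heq : f₁ x₀ = f₂ x₀) (hpos : 0 < f₂ x₀)
    (hint : x₀ ∈ interior {x : Ed d | 0 < f₂ x})
    (hdiff : DifferentiableAt ℝ (fun x => -Real.log (f₂ x)) x₀) :
    DifferentiableAt ℝ f₁ x₀ ∧ DifferentiableAt ℝ f₂ x₀ ∧
      fderiv ℝ f₁ x₀ = fderiv ℝ f₂ x₀ ∧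
      ∀ x, f₁ x ≤ f₂ x₀ *
        Real.exp (-(fderiv ℝ (fun y => -Real.log (f₂ y)) x₀ (x - x₀))) := by
  have hev : ∀ᶠ y in nhds x₀, 0 < f₂ y := mem_interior_iff_mem_nhds.1 hint
  have hL := hdiff.hasFDerivAt
  set L := fderiv ℝ (fun x => -Real.log (f₂ x)) x₀
  have hbound := h₁.le_mul_exp_of_touching hle heq hev hL
  have hf₂ : HasFDerivAt f₂ (f₂ x₀ • -L) x₀ := by
    have h := hL.fun_neg.exp
    rw [neg_neg, Real.exp_log hpos] at h
    refine h.congr_of_eventuallyEq ?_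
    filter_upwards [hev] with y hy
    rw [neg_neg, Real.exp_log hy]
  have hup : HasFDerivAt (fun x => f₂ x₀ * Real.exp (-(L (x - x₀)))) (f₂ x₀ • -L) x₀ := by
    have h := ((L.hasFDerivAt.comp x₀ ((hasFDerivAt_id x₀).sub_const x₀)).fun_neg.exp).const_mul
      (f₂ x₀)
    simpa using h
  have hf₁ : HasFDerivAt f₁ (f₂ x₀ • -L) x₀ := hf₂.of_le_of_le hup hle hbound (by simp)
  exact ⟨hf₁.differentiableAt, hf₂.differentiableAt, hf₁.fderiv.trans hf₂.fderiv.symm, hbound⟩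
end
end

section
/- Let d ≥ 1, s > 0 and let f be a log-concave function on ℝ^d with B^{d+1} ⊆ lift_s(f). Let ū ∈ ∂B^{d+1} ∩ ∂lift_s(f) be a contact point with ū ∉ ℝ^d, let u be the orthogonal projection of ū onto ℝ^d, and set w = √(1−|u|²) (so w > 0). Then f(x) ≤ w^s · e^{−(s/w²)⟨u, x − u⟩} for all x ∈ ℝ^d. -/
open MeasureTheory
open scoped BigOperators RealInnerProductSpace

noncomputable section

/-- The height function of the unit ball, raised to the power `s`, is below any `f` whose
`s`-lifting contains the ball. -/
theorem ball_height_le {d : ℕ} {s : ℝ} (hs : 0 < s) {f : Ed d → ℝ} (hf : ∀ x, 0 ≤ f x)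
    (hB : unitBallE d ⊆ sLift s f) (y : Ed d) :
    (max 0 (1 - ‖y‖ ^ 2)) ^ (s / 2) ≤ f y := by
  rcases le_total (1 - ‖y‖ ^ 2) 0 with h | h
  · rw [max_eq_left h, Real.zero_rpow (by positivity)]
    exact hf y
  · rw [max_eq_right h]
    have hm : (y, √(1 - ‖y‖ ^ 2)) ∈ unitBallE d := by
      simp only [unitBallE, Set.mem_ofPred_eq, Real.sq_sqrt h]
      linarith
    have hle : √(1 - ‖y‖ ^ 2) ≤ f y ^ (1 / s) := (le_abs_self _).trans (hB hm)
    calc (1 - ‖y‖ ^ 2) ^ (s / 2) = √(1 - ‖y‖ ^ 2) ^ s := by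
          rw [Real.sqrt_eq_rpow, ← Real.rpow_mul h]
          congr 1
          ring
      _ ≤ (f y ^ (1 / s)) ^ s := Real.rpow_le_rpow (Real.sqrt_nonneg _) hle hs.le
      _ = f y := by
          rw [← Real.rpow_mul (hf y), one_div_mul_cancel hs.ne', Real.rpow_one]

theorem eq_one_of_mem_frontier_unitBallE {d : ℕ} {u : Ed d × ℝ}
    (hu : u ∈ frontier (unitBallE d)) : ‖u.1‖ ^ 2 + u.2 ^ 2 = 1 :=
  frontier_le_subset_eq (f := fun p : Ed d × ℝ => ‖p.1‖ ^ 2 + p.2 ^ 2) (g := fun _ => 1)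
    (by fun_prop) continuous_const hu

/-- Log-concavity extrapolated through a boundary point of the lifting. -/
theorem rpow_mul_ball_height_le_of_mem_frontier {d : ℕ} {s : ℝ} (hs : 0 < s) {f : Ed d → ℝ}
    (hf : IsLogConcave f) (hB : unitBallE d ⊆ sLift s f) {u : Ed d × ℝ}
    (hu : u ∈ frontier (sLift s f)) (x : Ed d) {t : ℝ} (ht0 : 0 ≤ t) (ht1 : t < 1) :
    f x ^ t * ((max 0 (1 - ‖(1 - t)⁻¹ • (u.1 - t • x)‖ ^ 2)) ^ (s / 2)) ^ (1 - t) ≤ |u.2| ^ s := by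
  have ht : 0 < 1 - t := sub_pos.2 ht1
  have hcl : IsClosed {p : Ed d × ℝ | f x ^ t *
      ((max 0 (1 - ‖(1 - t)⁻¹ • (p.1 - t • x)‖ ^ 2)) ^ (s / 2)) ^ (1 - t) ≤ |p.2| ^ s} := by
    refine isClosed_le (continuous_const.mul ?_) ?_
    · refine Continuous.rpow_const (Continuous.rpow_const (by fun_prop) fun _ => Or.inr ?_)
        fun _ => Or.inr ht.le
      positivity
    · exact Continuous.rpow_const (by fun_prop) fun _ => Or.inr hs.le
  have hsub : (sLift s f)ᶜ ⊆ {p : Ed d × ℝ | f x ^ t *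
      ((max 0 (1 - ‖(1 - t)⁻¹ • (p.1 - t • x)‖ ^ 2)) ^ (s / 2)) ^ (1 - t) ≤ |p.2| ^ s} := by
    intro p hp
    have hlt : f p.1 ^ (1 / s) < |p.2| := not_le.1 hp
    have hpow : f p.1 ≤ |p.2| ^ s := by
      calc f p.1 = (f p.1 ^ (1 / s)) ^ s := by
            rw [← Real.rpow_mul (hf.1 _), one_div_mul_cancel hs.ne', Real.rpow_one]
        _ ≤ |p.2| ^ s := Real.rpow_le_rpow (Real.rpow_nonneg (hf.1 _) _) hlt.le hs.le
    have hconc := hf.2 x ((1 - t)⁻¹ • (p.1 - t • x)) t ht0 ht1.le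
    rw [smul_inv_smul₀ ht.ne', add_sub_cancel] at hconc
    refine le_trans ?_ (hconc.trans hpow)
    have hball := ball_height_le hs hf.1 hB ((1 - t)⁻¹ • (p.1 - t • x))
    exact mul_le_mul_of_nonneg_left (Real.rpow_le_rpow (by positivity) hball ht.le)
      (Real.rpow_nonneg (hf.1 _) _)
  rw [frontier_eq_closure_inter_closure] at hu
  exact closure_minimal hsub hcl hu.2

/-- **Tail bound from a contact point** (Corollary 3.2). -/
theorem contact_point_tail_bound (d : ℕ) (hd : 1 ≤ d) (s : ℝ) (hs : 0 < s)
    (f : Ed d → ℝ) (hf : IsLogConcave f)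
    (hB : unitBallE d ⊆ sLift s f)
    (u : Ed d × ℝ)
    (hu : u ∈ frontier (unitBallE d) ∩ frontier (sLift s f))
    (hu2 : u.2 ≠ 0) :
    ∀ x : Ed d, f x ≤ Real.sqrt (1 - ‖u.1‖ ^ 2) ^ s *
      Real.exp (-(s / (1 - ‖u.1‖ ^ 2)) * ⟪u.1, x - u.1⟫) := by
  intro x
  have hone := eq_one_of_mem_frontier_unitBallE hu.1
  have hw2 : 1 - ‖u.1‖ ^ 2 = |u.2| ^ 2 := by rw [sq_abs]; linarith
  rw [hw2, Real.sqrt_sq (abs_nonneg _)]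
  set w := |u.2| with hw
  have hwpos : 0 < w := abs_pos.2 hu2
  rcases (hf.1 x).eq_or_lt with h0 | hfx
  · rw [← h0]
    positivity
  set a := ⟪u.1, x - u.1⟫ with ha
  set b := ‖x - u.1‖ ^ 2 with hb
  have hexp (ε : ℝ) : 1 - ‖u.1 - ε • (x - u.1)‖ ^ 2 = w ^ 2 + 2 * ε * a - ε ^ 2 * b := by
    rw [norm_sub_sq_real, inner_smul_right, norm_smul, mul_pow, Real.norm_eq_abs, sq_abs, ← ha,
      ← hb, ← hw2]
    ring
  have hq : Continuous fun ε : ℝ => w ^ 2 + 2 * ε * a - ε ^ 2 * b := by fun_prop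
  have hev : ∀ᶠ ε : ℝ in nhdsWithin 0 (Set.Ioi 0),
      Real.log (f x) + s / 2 * ((2 * a - ε * b) / (w ^ 2 + 2 * ε * a - ε ^ 2 * b))
        ≤ s * Real.log w := by
    have hpos : ∀ᶠ ε : ℝ in nhdsWithin 0 (Set.Ioi 0), 0 < w ^ 2 + 2 * ε * a - ε ^ 2 * b :=
      (hq.continuousAt.eventually (lt_mem_nhds (by simp; positivity))).filter_mono
        nhdsWithin_le_nhds
    filter_upwards [hpos, self_mem_nhdsWithin] with ε hD hε
    have hε : 0 < ε := hε
    have h1ε : 0 < 1 + ε := by linarith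
    have ht : 1 - ε / (1 + ε) = (1 + ε)⁻¹ := by field_simp; ring
    have key := rpow_mul_ball_height_le_of_mem_frontier hs hf hB hu.2 x
      (t := ε / (1 + ε)) (by positivity) (by rw [div_lt_one h1ε]; linarith)
    have hpt : (1 - ε / (1 + ε))⁻¹ • (u.1 - (ε / (1 + ε)) • x) = u.1 - ε • (x - u.1) := by
      rw [ht, inv_inv, smul_sub, smul_smul, mul_div_cancel₀ _ h1ε.ne']
      module
    rw [hpt, hexp, max_eq_right hD.le, ht] at key
    have hlog := Real.log_le_log (by positivity) key
    rw [Real.log_mul (by positivity) (by positivity), Real.log_rpow hfx,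
      Real.log_rpow (by positivity), Real.log_rpow hD, Real.log_rpow hwpos] at hlog
    set D := w ^ 2 + 2 * ε * a - ε ^ 2 * b with hDdef
    have hlogD : 2 * Real.log w + ε * ((2 * a - ε * b) / D) ≤ Real.log D := by
      have h := Real.one_sub_inv_le_log_of_pos (x := D / w ^ 2) (by positivity)
      rw [Real.log_div hD.ne' (by positivity), Real.log_pow, inv_div] at h
      have : 1 - w ^ 2 / D = ε * ((2 * a - ε * b) / D) := by
        field_simp
        rw [hDdef]
        ring
      push_cast at h
      linarith
    have hmul : ε * Real.log (f x) + s / 2 * Real.log D ≤ (1 + ε) * (s * Real.log w) := by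
      have h := mul_le_mul_of_nonneg_left hlog h1ε.le
      refine le_trans (le_of_eq ?_) h
      field_simp
    have h2 := mul_le_mul_of_nonneg_left hlogD (by positivity : 0 ≤ s / 2)
    refine le_of_mul_le_mul_left ?_ hε
    linarith
  have hlim : Filter.Tendsto (fun ε : ℝ => Real.log (f x) +
      s / 2 * ((2 * a - ε * b) / (w ^ 2 + 2 * ε * a - ε ^ 2 * b)))
      (nhdsWithin 0 (Set.Ioi 0)) (nhds (Real.log (f x) + s / w ^ 2 * a)) := by
    have hc : ContinuousAt (fun ε : ℝ => Real.log (f x) +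
        s / 2 * ((2 * a - ε * b) / (w ^ 2 + 2 * ε * a - ε ^ 2 * b))) 0 := by
      refine continuousAt_const.add (continuousAt_const.mul
        (ContinuousAt.div (by fun_prop) hq.continuousAt ?_))
      simp
      positivity
    convert hc.tendsto.mono_left nhdsWithin_le_nhds using 2
    simp
    field_simp
  have hfin := le_of_tendsto hlim hev
  rw [← Real.log_le_log_iff hfx (by positivity), Real.log_mul (by positivity) (by positivity),
    Real.log_exp, Real.log_rpow hwpos]
  linarith
end
end

section
/- Fix s_1, s_2, β_1, β_2 > 0 with β_1 + β_2 = 1. Let f_1, f_2 be proper log-concave functions on ℝ^d and let Ē_1, Ē_2 be d-symmetric ellipsoids represented by (A_1⊕α_1, a_1) and (A_2⊕α_2, a_2) respectively, with Ē_1 ⊆ lift_{s_1}(f_1) and Ē_2 ⊆ lift_{s_2}(f_2). Set f = (β_1 ∗ f_1) ⋆ (β_2 ∗ f_2) (Asplund sum of epi-products), s = β_1 s_1 + β_2 s_2, A = β_1 A_1 + β_2 A_2, α = (α_1^{β_1 s_1} α_2^{β_2 s_2})^{1/s}, a = β_1 a_1 + β_2 a_2, and let Ē be the d-symmetric ellipsoid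 represented by (A⊕α, a). Then Ē ⊆ lift_s(f). -/
open MeasureTheory
open scoped BigOperators RealInnerProductSpace

noncomputable section

/-- A log-concave function with finite integral that is bounded below by a positive constant on a
ball is bounded above. -/
theorem IsLogConcave.bddAbove_range {d : ℕ} {f : Ed d → ℝ} (hf : IsLogConcave f)
    (hfin : (∫⁻ x, ENNReal.ofReal (f x)) < ⊤) {a : Ed d} {r c : ℝ} (hr : 0 < r) (hc : 0 < c)
    (hball : ∀ x ∈ Metric.closedBall a r, c ≤ f x) : BddAbove (Set.range f) := by
  set I := ∫⁻ x, ENNReal.ofReal (f x)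
  set V := volume (Metric.closedBall (0 : Ed d) (r / 2))
  have hV0 : V ≠ 0 := (Metric.measure_closedBall_pos _ _ (by positivity)).ne'
  have hVtop : V ≠ ⊤ := measure_closedBall_lt_top.ne
  have hVpos : 0 < V.toReal := ENNReal.toReal_pos hV0 hVtop
  set q := c ^ (1 / 2 : ℝ)
  have hq : 0 < q := by positivity
  refine ⟨(I.toReal / (q * V.toReal)) ^ 2, ?_⟩
  rintro _ ⟨z, rfl⟩
  have hz := hf.1 z
  set m := f z ^ (1 / 2 : ℝ) with hm
  have hm0 : 0 ≤ m := by positivity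
  set w : Ed d := (1 / 2 : ℝ) • z + (1 / 2 : ℝ) • a
  have hlow : ∀ x ∈ Metric.closedBall w (r / 2), m * q ≤ f x := by
    intro x hx
    set u : Ed d := (2 : ℝ) • x - z with hu
    have hua : u ∈ Metric.closedBall a r := by
      rw [mem_closedBall_iff_norm] at hx ⊢
      have : u - a = (2 : ℝ) • (x - w) := by simp only [hu, w]; module
      rw [this, norm_smul]
      norm_num
      linarith
    have h := hf.2 z u (1 / 2) (by norm_num) (by norm_num)
    have hx' : (1 / 2 : ℝ) • z + (1 - 1 / 2 : ℝ) • u = x := by simp only [hu]; module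
    rw [hx'] at h
    refine le_trans ?_ h
    rw [show (1 - 1 / 2 : ℝ) = 1 / 2 by norm_num]
    exact mul_le_mul_of_nonneg_left
      (Real.rpow_le_rpow hc.le (hball u hua) (by norm_num)) hm0
  have hint : ENNReal.ofReal (m * q) * V ≤ I := by
    calc ENNReal.ofReal (m * q) * V
        = ∫⁻ _ in Metric.closedBall w (r / 2), ENNReal.ofReal (m * q) := by
          rw [setLIntegral_const, Measure.addHaar_closedBall_center]
      _ ≤ ∫⁻ x in Metric.closedBall w (r / 2), ENNReal.ofReal (f x) :=
          setLIntegral_mono' Metric.isClosed_closedBall.measurableSet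
            fun x hx => ENNReal.ofReal_le_ofReal (hlow x hx)
      _ ≤ I := setLIntegral_le_lintegral _ _
  have hreal : m * q * V.toReal ≤ I.toReal := by
    have := ENNReal.toReal_mono hfin.ne hint
    rwa [ENNReal.toReal_mul, ENNReal.toReal_ofReal (by positivity)] at this
  have hmle : m ≤ I.toReal / (q * V.toReal) := by
    rw [le_div_iff₀ (by positivity)]
    linarith
  have hsq : f z = m ^ 2 := by
    rw [hm, ← Real.sqrt_eq_rpow, Real.sq_sqrt hz]
  rw [hsq]
  gcongr

/-- Points of an ellipsoid inside the `s`-lifting bound `f` from below. -/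
theorem rpow_le_of_ellE_subset_sLift {d : ℕ} {s : ℝ} (hs : 0 < s) {f : Ed d → ℝ}
    (hf : ∀ x, 0 ≤ f x) {A : Matrix (Fin d) (Fin d) ℝ} {α : ℝ} {a : Ed d} (hα : 0 < α)
    (h : ellE A α a ⊆ sLift s f) {y : Ed d} {t : ℝ} (hy : ‖y‖ ^ 2 + t ^ 2 ≤ 1) :
    (α * |t|) ^ s ≤ f (Matrix.toEuclideanLin A y + a) := by
  have h' : |α * t| ≤ f (Matrix.toEuclideanLin A y + a) ^ (1 / s) :=
    h (show (Matrix.toEuclideanLin A y + a, α * t) ∈ ellE A α a from ⟨y, t, hy, rfl, rfl⟩)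
  rw [abs_mul, abs_of_pos hα] at h'
  calc (α * |t|) ^ s ≤ (f (Matrix.toEuclideanLin A y + a) ^ (1 / s)) ^ s :=
        Real.rpow_le_rpow (by positivity) h' hs.le
    _ = f (Matrix.toEuclideanLin A y + a) := by
        rw [← Real.rpow_mul (hf _), one_div_mul_cancel hs.ne', Real.rpow_one]

/-- A proper log-concave function whose `s`-lifting contains a nondegenerate ellipsoid is
bounded above. -/
theorem ProperLogConcave.bddAbove_range {d : ℕ} {s : ℝ} (hs : 0 < s) {f : Ed d → ℝ}
    (hf : ProperLogConcave f) {A : Matrix (Fin d) (Fin d) ℝ} {α : ℝ} {a : Ed d}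
    (hA : A.PosDef) (hα : 0 < α) (h : ellE A α a ⊆ sLift s f) : BddAbove (Set.range f) := by
  have hcont : Continuous fun x : Ed d => Matrix.toEuclideanLin A⁻¹ (x - a) :=
    (LinearMap.continuous_of_finiteDimensional _).comp (continuous_id.sub continuous_const)
  have hnhds : {x : Ed d | ‖Matrix.toEuclideanLin A⁻¹ (x - a)‖ < 1 / 2} ∈ nhds a :=
    (isOpen_lt hcont.norm continuous_const).mem_nhds (by simp)
  obtain ⟨r, hr, hsub⟩ := Metric.nhds_basis_closedBall.mem_iff.1 hnhds
  refine hf.1.bddAbove_range hf.2.2.2 (a := a) (r := r) (c := (α * |1 / 2|) ^ s) hr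
    (by positivity) fun x hx => ?_
  have hx' : ‖Matrix.toEuclideanLin A⁻¹ (x - a)‖ < 1 / 2 := hsub hx
  have hb := rpow_le_of_ellE_subset_sLift hs hf.1.1 hα h
    (y := Matrix.toEuclideanLin A⁻¹ (x - a)) (t := 1 / 2)
    (by nlinarith [norm_nonneg (Matrix.toEuclideanLin A⁻¹ (x - a))])
  have hinv : Matrix.toEuclideanLin A (Matrix.toEuclideanLin A⁻¹ (x - a)) + a = x := by
    have : IsUnit A.det := hA.det_pos.ne'.isUnit
    simp [Matrix.toLpLin_apply, Matrix.mulVec_mulVec, Matrix.mul_nonsing_inv A this]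
  rwa [hinv] at hb

/-- The value of `f₁^β₁ f₂^β₂` at a decomposition bounds the Asplund sum from below, for
nonnegative functions bounded above. -/
theorem rpow_mul_rpow_le_asplund_epiProd {d : ℕ} {β₁ β₂ : ℝ} (hβ₁ : 0 < β₁) (hβ₂ : 0 < β₂)
    {f₁ f₂ : Ed d → ℝ} (hf₁ : ∀ x, 0 ≤ f₁ x) (hf₂ : ∀ x, 0 ≤ f₂ x)
    (hb₁ : BddAbove (Set.range f₁)) (hb₂ : BddAbove (Set.range f₂)) (x₁ x₂ : Ed d) :
    f₁ x₁ ^ β₁ * f₂ x₂ ^ β₂ ≤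
      asplund (epiProd β₁ f₁) (epiProd β₂ f₂) (β₁ • x₁ + β₂ • x₂) := by
  obtain ⟨M₁, hM₁⟩ := hb₁
  obtain ⟨M₂, hM₂⟩ := hb₂
  have hbdd : BddAbove (Set.range fun y : Ed d =>
      epiProd β₁ f₁ y * epiProd β₂ f₂ (β₁ • x₁ + β₂ • x₂ - y)) := by
    refine ⟨M₁ ^ β₁ * M₂ ^ β₂, ?_⟩
    rintro _ ⟨y, rfl⟩
    have hM₁0 : 0 ≤ M₁ := (hf₁ 0).trans (hM₁ ⟨0, rfl⟩)
    exact mul_le_mul (Real.rpow_le_rpow (hf₁ _) (hM₁ ⟨_, rfl⟩) hβ₁.le)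
      (Real.rpow_le_rpow (hf₂ _) (hM₂ ⟨_, rfl⟩) hβ₂.le)
      (Real.rpow_nonneg (hf₂ _) _) (Real.rpow_nonneg hM₁0 _)
  have h := le_ciSup hbdd (β₁ • x₁)
  simpa only [asplund, epiProd, add_sub_cancel_left, smul_smul, inv_mul_cancel₀ hβ₁.ne',
    inv_mul_cancel₀ hβ₂.ne', one_smul] using h

/-- **Containment of the interpolated ellipsoid** (Lemma 4.1). -/
theorem interpolated_ellipsoid_containment (d : ℕ)
    (s₁ s₂ β₁ β₂ : ℝ) (hs₁ : 0 < s₁) (hs₂ : 0 < s₂)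
    (hβ₁ : 0 < β₁) (hβ₂ : 0 < β₂) (hβ : β₁ + β₂ = 1)
    (f₁ f₂ : Ed d → ℝ) (hf₁ : ProperLogConcave f₁) (hf₂ : ProperLogConcave f₂)
    (A₁ A₂ : Matrix (Fin d) (Fin d) ℝ) (α₁ α₂ : ℝ) (a₁ a₂ : Ed d)
    (hA₁ : A₁.PosDef) (hA₂ : A₂.PosDef) (hα₁ : 0 < α₁) (hα₂ : 0 < α₂)
    (h₁ : ellE A₁ α₁ a₁ ⊆ sLift s₁ f₁) (h₂ : ellE A₂ α₂ a₂ ⊆ sLift s₂ f₂) :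
    ellE (β₁ • A₁ + β₂ • A₂)
        ((α₁ ^ (β₁ * s₁) * α₂ ^ (β₂ * s₂)) ^ (1 / (β₁ * s₁ + β₂ * s₂)))
        (β₁ • a₁ + β₂ • a₂) ⊆
      sLift (β₁ * s₁ + β₂ * s₂) (asplund (epiProd β₁ f₁) (epiProd β₂ f₂)) := by
  rintro ⟨x, τ⟩ ⟨y, t, hy, hx, hτ⟩
  simp only at hx hτ
  subst hx hτ
  have hs : 0 < β₁ * s₁ + β₂ * s₂ := by positivity
  have hsum : Matrix.toEuclideanLin (β₁ • A₁ + β₂ • A₂) y + (β₁ • a₁ + β₂ • a₂) =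
      β₁ • (Matrix.toEuclideanLin A₁ y + a₁) + β₂ • (Matrix.toEuclideanLin A₂ y + a₂) := by
    simp only [map_add, map_smul, LinearMap.add_apply, LinearMap.smul_apply]
    module
  have hl₁ := rpow_le_of_ellE_subset_sLift hs₁ hf₁.1.1 hα₁ h₁ hy
  have hl₂ := rpow_le_of_ellE_subset_sLift hs₂ hf₂.1.1 hα₂ h₂ hy
  have hle := rpow_mul_rpow_le_asplund_epiProd hβ₁ hβ₂ hf₁.1.1 hf₂.1.1
    (hf₁.bddAbove_range hs₁ hA₁ hα₁ h₁) (hf₂.bddAbove_range hs₂ hA₂ hα₂ h₂)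
    (Matrix.toEuclideanLin A₁ y + a₁) (Matrix.toEuclideanLin A₂ y + a₂)
  set P := α₁ ^ (β₁ * s₁) * α₂ ^ (β₂ * s₂) with hP
  have hP0 : 0 < P := by positivity
  have hprod : P * |t| ^ (β₁ * s₁ + β₂ * s₂) =
      ((α₁ * |t|) ^ s₁) ^ β₁ * ((α₂ * |t|) ^ s₂) ^ β₂ := by
    have ht := abs_nonneg t
    rw [← Real.rpow_mul (by positivity), ← Real.rpow_mul (by positivity),
      Real.mul_rpow hα₁.le ht, Real.mul_rpow hα₂.le ht,
      Real.rpow_add_of_nonneg ht (by positivity) (by positivity), hP,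
      mul_comm s₁ β₁, mul_comm s₂ β₂]
    ring
  have hF : P * |t| ^ (β₁ * s₁ + β₂ * s₂) ≤
      asplund (epiProd β₁ f₁) (epiProd β₂ f₂)
        (β₁ • (Matrix.toEuclideanLin A₁ y + a₁) + β₂ • (Matrix.toEuclideanLin A₂ y + a₂)) := by
    rw [hprod]
    refine le_trans ?_ hle
    gcongr
    exact Real.rpow_nonneg (hf₁.1.1 _) _
  change |P ^ (1 / (β₁ * s₁ + β₂ * s₂)) * t| ≤ _ ^ (1 / (β₁ * s₁ + β₂ * s₂))
  rw [hsum, abs_mul, abs_of_pos (by positivity)]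
  calc P ^ (1 / (β₁ * s₁ + β₂ * s₂)) * |t|
      = (P * |t| ^ (β₁ * s₁ + β₂ * s₂)) ^ (1 / (β₁ * s₁ + β₂ * s₂)) := by
        rw [Real.mul_rpow hP0.le (by positivity), ← Real.rpow_mul (abs_nonneg t),
          mul_one_div_cancel hs.ne', Real.rpow_one]
    _ ≤ _ := Real.rpow_le_rpow (by positivity) hF (by positivity)
end
end

section
/- Let f be a proper log-concave function on ℝ^d and s > 0. Let A ∈ ℝ^{d×d} be positive definite, α > 0, δ > 0, and set a_1 = δ A e_1 and a_2 = −δ A e_1, where e_1 is the first standard basis vector of ℝ^d. Assume the d-symmetric ellipsoids represented by (A⊕α, a_1) and (A⊕α, a_2) are both contained in lift_s(f). Then the d-symmetric ellipsoid Ē_0 = (A⊕α) M̄ B^{d+1}, where M̄ = diag(1+δ, 1, …, 1) is the (d+1)×(d+1) diagonal matrix with first entry 1+δ and all other entries 1, is also contained in lift_s(f). -/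
open MeasureTheory
open scoped BigOperators RealInnerProductSpace

noncomputable section

/-- Log-concave functions are quasi-concave. -/
theorem IsLogConcave.le_combo {d : ℕ} {f : Ed d → ℝ} (hf : IsLogConcave f) {m : ℝ} (hm : 0 ≤ m)
    {x y : Ed d} (hx : m ≤ f x) (hy : m ≤ f y) {t : ℝ} (ht₀ : 0 ≤ t) (ht₁ : t ≤ 1) :
    m ≤ f (t • x + (1 - t) • y) := by
  have ht : 0 ≤ 1 - t := sub_nonneg.2 ht₁
  calc m = m ^ t * m ^ (1 - t) := by
        rw [← Real.rpow_add_of_nonneg hm ht₀ ht, add_sub_cancel, Real.rpow_one]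
    _ ≤ f x ^ t * f y ^ (1 - t) :=
        mul_le_mul (Real.rpow_le_rpow hm hx ht₀) (Real.rpow_le_rpow hm hy ht)
          (Real.rpow_nonneg hm _) (Real.rpow_nonneg (hf.1 x) _)
    _ ≤ _ := hf.2 x y t ht₀ ht₁

/-- The lifting of a log-concave function has convex slices at every fixed height. -/
theorem IsLogConcave.sLift_combo_mem {d : ℕ} {f : Ed d → ℝ} (hf : IsLogConcave f) {s : ℝ}
    (hs : 0 < s) {x y : Ed d} {h : ℝ} (hx : (x, h) ∈ sLift s f) (hy : (y, h) ∈ sLift s f)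
    {t : ℝ} (ht₀ : 0 ≤ t) (ht₁ : t ≤ 1) : (t • x + (1 - t) • y, h) ∈ sLift s f := by
  simp only [sLift, Set.mem_ofPred_eq, one_div] at *
  rw [Real.le_rpow_inv_iff_of_pos (abs_nonneg h) (hf.1 _) hs] at *
  exact hf.le_combo (Real.rpow_nonneg (abs_nonneg h) s) hx hy ht₀ ht₁

/-- Stretching the `i`-th coordinate by `1 + δ` adds `δ * y i` in the direction `i`. -/
theorem toEuclideanLin_mul_diagonal_ite {d : ℕ} (A : Matrix (Fin d) (Fin d) ℝ) (i : Fin d)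
    (δ : ℝ) (y : Ed d) :
    Matrix.toEuclideanLin (A * Matrix.diagonal fun j => if j = i then 1 + δ else 1) y =
      Matrix.toEuclideanLin A y +
        (δ * y i) • Matrix.toEuclideanLin A (EuclideanSpace.single i 1) := by
  have h : Matrix.toEuclideanLin (Matrix.diagonal fun j => if j = i then 1 + δ else 1) y =
      y + (δ * y i) • EuclideanSpace.single i (1 : ℝ) := by
    ext j
    by_cases hj : j = i
    · subst hj
      simp [Matrix.toLpLin_apply, Matrix.mulVec_diagonal]
      ring
    · simp [Matrix.toLpLin_apply, Matrix.mulVec_diagonal, hj]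
  rw [← map_smul, ← map_add, ← h]
  simp [Matrix.toLpLin_apply]

/-- **Interpolation between translated ellipsoids** (Lemma 4.3). -/
theorem interpolation_translates (d : ℕ) (hd : 0 < d) (s : ℝ) (hs : 0 < s)
    (f : Ed d → ℝ) (hf : ProperLogConcave f)
    (A : Matrix (Fin d) (Fin d) ℝ) (hA : A.PosDef) (α : ℝ) (hα : 0 < α)
    (δ : ℝ) (hδ : 0 < δ)
    (h₁ : ellE A α
        (δ • Matrix.toEuclideanLin A (EuclideanSpace.single (⟨0, hd⟩ : Fin d) 1)) ⊆
      sLift s f)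
    (h₂ : ellE A α
        (-(δ • Matrix.toEuclideanLin A (EuclideanSpace.single (⟨0, hd⟩ : Fin d) 1))) ⊆
      sLift s f) :
    ellE (A * Matrix.diagonal (fun i : Fin d => if i = ⟨0, hd⟩ then 1 + δ else 1))
      α 0 ⊆ sLift s f := by
  rintro ⟨p, h⟩ ⟨y, t, hyt, hp, hh⟩
  dsimp only at hp hh
  set i : Fin d := ⟨0, hd⟩
  set v := Matrix.toEuclideanLin A (EuclideanSpace.single i 1)
  have hyi : |y i| ≤ 1 := by
    have h_coord : |y i| ≤ ‖y‖ := PiLp.norm_apply_le y i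
    nlinarith [sq_nonneg t, norm_nonneg y]
  obtain ⟨hl, hu⟩ := abs_le.1 hyi
  have hx₁ : (Matrix.toEuclideanLin A y + δ • v, h) ∈ sLift s f := h₁ ⟨y, t, hyt, rfl, hh⟩
  have hx₂ : (Matrix.toEuclideanLin A y + -(δ • v), h) ∈ sLift s f := h₂ ⟨y, t, hyt, rfl, hh⟩
  have hcombo : p = ((1 + y i) / 2) • (Matrix.toEuclideanLin A y + δ • v) +
      (1 - (1 + y i) / 2) • (Matrix.toEuclideanLin A y + -(δ • v)) := by
    rw [hp, toEuclideanLin_mul_diagonal_ite]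
    module
  rw [hcombo]
  exact hf.1.sLift_combo_mem hs hx₁ hx₂ (by linarith) (by linarith)
end
end
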